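/- Let n ≥ 2, s ∈ (0,1) and ε₀ > 0, and let {E^k}_{k∈ℕ} be a generalized minimizer of Ẽ_s for some ε ∈ (0, ε₀], i.e. a minimizer of Ẽ_s among sequences of measurable sets with total volume ω_n. Then for every k ∈ ℕ the set E^k is a (ρ,R)-minimizer of the s-perimeter with ρ(r) = ε₀ (10 n ω_n/(n−s)) r^{n−s}, for R sufficiently small: for every x ∈ ℝⁿ, every r ≤ R, and every measurable F ⊂ ℝⁿ with E^k Δ F compactly contained in B_r(x), one has P_s(E^k) ≤ P_s(F) + ε₀ (10 n ω_n/(n−s)) r^{n−s}. -/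

import Mathlib

open MeasureTheory Metric Set Filter
open scoped ENNReal NNReal symmDiff Topology

noncomputable section

/-- The ambient Euclidean space `ℝⁿ`. -/
abbrev Rn (n : ℕ) := EuclideanSpace ℝ (Fin n)

/-- The fractional `s`-perimeter `P_s(E) = ∫_E ∫_{Eᶜ} |x-y|^{-(n+s)} dx dy`. -/
def fracPer (n : ℕ) (s : ℝ) (E : Set (Rn n)) : ℝ≥0∞ :=
  ∫⁻ x in E, ∫⁻ y in Eᶜ, ENNReal.ofReal (‖x - y‖ ^ (-((n : ℝ) + s)))

/-- The Riesz-type potential `∫_E |x-y|^{-s} dx` of `E` evaluated at `y`. -/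
def rieszAt (n : ℕ) (s : ℝ) (E : Set (Rn n)) (y : Rn n) : ℝ≥0∞ :=
  ∫⁻ x in E, ENNReal.ofReal (‖x - y‖ ^ (-s))

/-- `V_s(E) = max_{y ∈ ℝⁿ} ∫_E |x-y|^{-s} dx`. -/
def Vs (n : ℕ) (s : ℝ) (E : Set (Rn n)) : ℝ≥0∞ := ⨆ y : Rn n, rieszAt n s E y

/-- `ω_n`, the volume of the unit ball of `ℝⁿ`. -/
def unitBallVol (n : ℕ) : ℝ := (volume (ball (0 : Rn n) 1)).toReal

/-- The radius `r` such that `|B_r| = |E|`. -/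
def ballRad (n : ℕ) (E : Set (Rn n)) : ℝ :=
  ((volume E).toReal / unitBallVol n) ^ ((1 : ℝ) / n)

/-- The fractional isoperimetric deficit `δ_s(E) = (P_s(E) - P_s(B_r))/P_s(B_r)`,
where `|B_r| = |E|`. -/
def fracDeficit (n : ℕ) (s : ℝ) (E : Set (Rn n)) : ℝ :=
  ((fracPer n s E).toReal - (fracPer n s (ball (0 : Rn n) (ballRad n E))).toReal) /
    (fracPer n s (ball (0 : Rn n) (ballRad n E))).toReal

/-- The normalization constant `c_{n,s} = P_s(B₁)(n-s)/(n ω_n)`. -/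
def cns (n : ℕ) (s : ℝ) : ℝ :=
  (fracPer n s (ball (0 : Rn n) 1)).toReal * ((n : ℝ) - s) / (n * unitBallVol n)

/-- The strong asymmetry index
`A_s(E) = min_y { |E Δ B_r(y)|/|B_r| + ((P_s(E) - c_{n,s} ∫_E |x-y|^{-s} dx)/P_s(B_r))^{1/2} }`,
with `|B_r| = |E|`. -/
def asymA (n : ℕ) (s : ℝ) (E : Set (Rn n)) : ℝ :=
  ⨅ y : Rn n,
    ((volume (E ∆ ball y (ballRad n E))).toReal /
        (volume (ball (0 : Rn n) (ballRad n E))).toReal +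
      Real.sqrt (((fracPer n s E).toReal - cns n s * (rieszAt n s E y).toReal) /
        (fracPer n s (ball (0 : Rn n) (ballRad n E))).toReal))

/-- The oscillation index `β_s(E) = ((P_s(E) - c_{n,s} V_s(E))/P_s(B_r))^{1/2}`,
with `|B_r| = |E|`. -/
def betaS (n : ℕ) (s : ℝ) (E : Set (Rn n)) : ℝ :=
  Real.sqrt (((fracPer n s E).toReal - cns n s * (Vs n s E).toReal) /
    (fracPer n s (ball (0 : Rn n) (ballRad n E))).toReal)

/-- The asymmetry index `ζ_s(E) = (V_s(B_r) - V_s(E))/V_s(B_r)`, with `|B_r| = |E|`. -/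
def zetaS (n : ℕ) (s : ℝ) (E : Set (Rn n)) : ℝ :=
  ((Vs n s (ball (0 : Rn n) (ballRad n E))).toReal - (Vs n s E).toReal) /
    (Vs n s (ball (0 : Rn n) (ballRad n E))).toReal

/-- The Fraenkel asymmetry `α(E) = min_y |E Δ B_r(y)|/|B_r|`, with `|B_r| = |E|`. -/
def fraenkel (n : ℕ) (E : Set (Rn n)) : ℝ :=
  ⨅ y : Rn n, (volume (E ∆ ball y (ballRad n E))).toReal /
    (volume (ball (0 : Rn n) (ballRad n E))).toReal

/-- The fractional Cheeger constant `h_{m,s}(Ω) = inf { P_s(E)/|E|^m : E ⊆ Ω }`. -/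
def cheeger (n : ℕ) (m s : ℝ) (Ω : Set (Rn n)) : ℝ :=
  sInf {x : ℝ | ∃ E : Set (Rn n), E ⊆ Ω ∧ MeasurableSet E ∧ 0 < volume E ∧
    x = (fracPer n s E).toReal / (volume E).toReal ^ m}

/-- The energy functional `E_s(E) = P_s(E) + ε V_s(E)`. -/
def energy (n : ℕ) (s ε : ℝ) (E : Set (Rn n)) : ℝ≥0∞ :=
  fracPer n s E + ENNReal.ofReal ε * Vs n s E

/-- The generalized energy functional `Ẽ_s({E^k}) = Σ_k E_s(E^k)`. -/
def genEnergy (n : ℕ) (s ε : ℝ) (F : ℕ → Set (Rn n)) : ℝ≥0∞ :=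
  ∑' k : ℕ, energy n s ε (F k)

/-- Absolute difference in `ℝ≥0∞` (equal to `|a - b|` for finite values). -/
def ennAbsDiff (a b : ℝ≥0∞) : ℝ≥0∞ := (a - b) + (b - a)

/-- The penalized generalized functional `Ẽ_{s,Λ}({E^k}) = Ẽ_s({E^k}) + Λ |Σ_k |E^k| - ω_n|`. -/
def penEnergy (n : ℕ) (s ε Λ : ℝ) (F : ℕ → Set (Rn n)) : ℝ≥0∞ :=
  genEnergy n s ε F +
    ENNReal.ofReal Λ * ennAbsDiff (∑' k : ℕ, volume (F k)) (volume (ball (0 : Rn n) 1))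

/-- `E` is a minimizer of `min { P_s(E) + ε V_s(E) : E ⊆ ℝⁿ measurable, |E| = ω_n }`. -/
def IsEnergyMin (n : ℕ) (s ε : ℝ) (E : Set (Rn n)) : Prop :=
  MeasurableSet E ∧ volume E = volume (ball (0 : Rn n) 1) ∧
    ∀ F : Set (Rn n), MeasurableSet F → volume F = volume (ball (0 : Rn n) 1) →
      energy n s ε E ≤ energy n s ε F

open scoped Pointwise

lemma lintegral_radial {n : ℕ} (hn : 0 < n) {f : ℝ → ℝ} (hf : ∀ y, 0 ≤ f y)
    (hint : IntegrableOn (fun y : ℝ => y ^ (n - 1) * f y) (Ioi 0)) :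
    ∫⁻ x : Rn n, ENNReal.ofReal (f ‖x‖) =
      ENNReal.ofReal (n * unitBallVol n * ∫ y in Ioi (0 : ℝ), y ^ (n - 1) * f y) := by
  have : Nonempty (Fin n) := ⟨⟨0, hn⟩⟩
  rw [← ofReal_integral_eq_lintegral_ofReal, integral_fun_norm_addHaar volume f]
  · simp [unitBallVol, measureReal_def, mul_assoc]
  · rw [integrable_fun_norm_addHaar volume (f := f)]
    simpa using hint
  · exact Eventually.of_forall fun x => hf _

lemma pow_mul_rpow_neg {n : ℕ} (hn : 0 < n) {y : ℝ} (hy : 0 < y) (a : ℝ) :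
    y ^ (n - 1) * y ^ (-a) = y ^ ((n : ℝ) - a - 1) := by
  rw [← Real.rpow_natCast, ← Real.rpow_add hy, Nat.cast_pred hn]
  congr 1
  ring

lemma setLIntegral_ball_norm_rpow_neg {n : ℕ} (hn : 0 < n) {s r : ℝ} (hs : s < n) (hr : 0 ≤ r) :
    ∫⁻ z in ball (0 : Rn n) r, ENNReal.ofReal (‖z‖ ^ (-s)) =
      ENNReal.ofReal (n * unitBallVol n / (n - s) * r ^ ((n : ℝ) - s)) := by
  set f : ℝ → ℝ := (Ico 0 r).indicator fun y => y ^ (-s)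
  have hf : ∀ y, 0 ≤ f y := fun y =>
    indicator_nonneg (fun z hz => Real.rpow_nonneg hz.1 _) y
  have hcongr : ∀ y ∈ Ioi (0 : ℝ), y ^ (n - 1) * f y =
      (Ioo 0 r).indicator (fun y => y ^ ((n : ℝ) - s - 1)) y := by
    intro y hy
    rw [mem_Ioi] at hy
    by_cases h : y < r
    · simp [f, indicator, hy, hy.le, h, pow_mul_rpow_neg hn hy]
    · simp [f, indicator, h]
  have hI : IntervalIntegrable (fun y : ℝ => y ^ ((n : ℝ) - s - 1)) volume 0 r :=
    intervalIntegral.intervalIntegrable_rpow' (by linarith)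
  have hint : IntegrableOn (fun y : ℝ => y ^ (n - 1) * f y) (Ioi 0) := by
    rw [integrableOn_congr_fun hcongr measurableSet_Ioi]
    apply Integrable.integrableOn
    rw [integrable_indicator_iff measurableSet_Ioo]
    exact (intervalIntegrable_iff_integrableOn_Ioo_of_le hr).1 hI
  have hval : ∫ y in Ioi (0 : ℝ), y ^ (n - 1) * f y = r ^ ((n : ℝ) - s) / (n - s) := by
    rw [setIntegral_congr_fun measurableSet_Ioi hcongr, setIntegral_indicator measurableSet_Ioo,
      inter_eq_right.2 Ioo_subset_Ioi_self, ← integral_Ioc_eq_integral_Ioo,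
      ← intervalIntegral.integral_of_le hr, integral_rpow (Or.inl (by linarith)),
      sub_add_cancel, Real.zero_rpow (by linarith), sub_zero]
  rw [← lintegral_indicator measurableSet_ball]
  have h1 : ∀ z : Rn n, (ball (0 : Rn n) r).indicator
      (fun z => ENNReal.ofReal (‖z‖ ^ (-s))) z = ENNReal.ofReal (f ‖z‖) := by
    intro z
    by_cases h : ‖z‖ < r <;> simp [f, indicator, h]
  simp_rw [h1]
  rw [lintegral_radial hn hf hint, hval]
  congr 1
  ring

lemma setLIntegral_compl_ball_norm_rpow_neg {n : ℕ} (hn : 0 < n) {s d : ℝ} (hs : 0 < s)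
    (hd : 0 < d) :
    ∫⁻ z in (ball (0 : Rn n) d)ᶜ, ENNReal.ofReal (‖z‖ ^ (-((n : ℝ) + s))) =
      ENNReal.ofReal (n * unitBallVol n / s * d ^ (-s)) := by
  set f : ℝ → ℝ := (Ici d).indicator fun y => y ^ (-((n : ℝ) + s))
  have hf : ∀ y, 0 ≤ f y := fun y =>
    indicator_nonneg (fun z hz => Real.rpow_nonneg (hd.le.trans hz) _) y
  have hcongr : ∀ y ∈ Ioi (0 : ℝ), y ^ (n - 1) * f y =
      (Ici d).indicator (fun y => y ^ (-s - 1)) y := by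
    intro y hy
    rw [mem_Ioi] at hy
    by_cases h : d ≤ y
    · simp only [f, indicator, mem_Ici, h, if_true, pow_mul_rpow_neg hn hy]
      congr 1
      ring
    · simp [f, indicator, h]
  have hint : IntegrableOn (fun y : ℝ => y ^ (n - 1) * f y) (Ioi 0) := by
    rw [integrableOn_congr_fun hcongr measurableSet_Ioi]
    apply Integrable.integrableOn
    rw [integrable_indicator_iff measurableSet_Ici, integrableOn_Ici_iff_integrableOn_Ioi]
    exact integrableOn_Ioi_rpow_of_lt (by linarith) hd
  have hval : ∫ y in Ioi (0 : ℝ), y ^ (n - 1) * f y = d ^ (-s) / s := by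
    rw [setIntegral_congr_fun measurableSet_Ioi hcongr, setIntegral_indicator measurableSet_Ici,
      inter_eq_right.2 (Ici_subset_Ioi.2 hd), integral_Ici_eq_integral_Ioi,
      integral_Ioi_rpow_of_lt (by linarith) hd, sub_add_cancel, neg_div_neg_eq]
  rw [← lintegral_indicator measurableSet_ball.compl]
  have h1 : ∀ z : Rn n, (ball (0 : Rn n) d)ᶜ.indicator
      (fun z => ENNReal.ofReal (‖z‖ ^ (-((n : ℝ) + s)))) z = ENNReal.ofReal (f ‖z‖) := by
    intro z
    by_cases h : d ≤ ‖z‖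
    · simp [f, indicator, h]
    · simp [f, indicator, h]
  simp_rw [h1]
  rw [lintegral_radial hn hf hint, hval]
  congr 1
  ring

lemma fracPer_unitBall_ne_top {n : ℕ} (hn : 0 < n) {s : ℝ} (hs : s ∈ Ioo (0 : ℝ) 1) :
    fracPer n s (ball (0 : Rn n) 1) ≠ ∞ := by
  have : Nonempty (Fin n) := ⟨⟨0, hn⟩⟩
  set C : ℝ := n * unitBallVol n / s
  have hint : IntegrableOn (fun x : Rn n => C * (1 - ‖x‖) ^ (-s)) (ball (0 : Rn n) 1) := by
    rw [integrableOn_fun_norm_addHaar volume (f := fun y => C * (1 - y) ^ (-s)),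
      ← intervalIntegrable_iff_integrableOn_Ioo_of_le zero_le_one]
    have h0 : IntervalIntegrable (fun y : ℝ => y ^ (-s)) volume 0 1 :=
      intervalIntegral.intervalIntegrable_rpow' (by linarith [hs.2])
    have h1 : IntervalIntegrable (fun y : ℝ => (1 - y) ^ (-s)) volume 0 1 := by
      simpa using (h0.comp_sub_left 1).symm
    exact (h1.const_mul C).continuousOn_mul (by fun_prop)
  refine ne_top_of_le_ne_top hint.lintegral_lt_top.ne (setLIntegral_mono' measurableSet_ball ?_)
  intro x hx
  have hx1 : 0 < 1 - ‖x‖ := by simpa using hx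
  rw [← setLIntegral_compl_ball_norm_rpow_neg hn hs.1 hx1,
    ← lintegral_indicator measurableSet_ball.compl, ← lintegral_indicator measurableSet_ball.compl,
    ← lintegral_sub_left_eq_self
      ((ball (0 : Rn n) (1 - ‖x‖))ᶜ.indicator fun z => ENNReal.ofReal (‖z‖ ^ (-((n : ℝ) + s)))) x]
  refine lintegral_mono fun y => ?_
  by_cases hy : y ∈ (ball (0 : Rn n) 1)ᶜ
  · have hxy : x - y ∈ (ball (0 : Rn n) (1 - ‖x‖))ᶜ := by
      simp only [mem_compl_iff, mem_ball, dist_zero_right, not_lt] at hy ⊢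
      linarith [norm_sub_norm_le y x, norm_sub_rev x y]
    rw [indicator_of_mem hy, indicator_of_mem hxy]
  · rw [indicator_of_notMem hy]
    exact zero_le

lemma rieszAt_ball_le {n : ℕ} (hn : 0 < n) {s : ℝ} (hs : s ∈ Ico (0 : ℝ) n) {r : ℝ} (hr : 0 < r)
    (x y : Rn n) :
    rieszAt n s (ball x r) y ≤
      ENNReal.ofReal (2 * (n * unitBallVol n / (n - s)) * r ^ ((n : ℝ) - s)) := by
  have : Nonempty (Fin n) := ⟨⟨0, hn⟩⟩
  have hω : 0 ≤ unitBallVol n := ENNReal.toReal_nonneg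
  have hns : 0 < (n : ℝ) - s := sub_pos.2 hs.2
  have hnear : ∫⁻ z in ball y r, ENNReal.ofReal (‖z - y‖ ^ (-s)) =
      ENNReal.ofReal (n * unitBallVol n / (n - s) * r ^ ((n : ℝ) - s)) := by
    rw [← setLIntegral_ball_norm_rpow_neg hn hs.2 hr.le, ← lintegral_indicator measurableSet_ball,
      ← lintegral_indicator measurableSet_ball, ← lintegral_sub_right_eq_self
        ((ball (0 : Rn n) r).indicator fun z => ENNReal.ofReal (‖z‖ ^ (-s))) y]
    congr 1 with z
    simp [indicator, dist_eq_norm]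
  have hfar : ∫⁻ z in ball x r \ ball y r, ENNReal.ofReal (‖z - y‖ ^ (-s)) ≤
      ENNReal.ofReal (n * unitBallVol n / (n - s) * r ^ ((n : ℝ) - s)) := calc
    _ ≤ ∫⁻ z in ball x r \ ball y r, ENNReal.ofReal (r ^ (-s)) := by
      refine setLIntegral_mono' (measurableSet_ball.diff measurableSet_ball) fun z hz => ?_
      have hz2 : r ≤ ‖z - y‖ := by simpa [dist_eq_norm] using hz.2
      exact ENNReal.ofReal_le_ofReal
        (Real.rpow_le_rpow_of_nonpos hr hz2 (neg_nonpos.2 hs.1))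
    _ ≤ ENNReal.ofReal (r ^ (-s)) * volume (ball x r) := by
      rw [setLIntegral_const]
      gcongr
      exact sdiff_subset
    _ = ENNReal.ofReal (unitBallVol n * r ^ ((n : ℝ) - s)) := by
      rw [Measure.addHaar_ball volume x hr.le, finrank_euclideanSpace, Fintype.card_fin,
        ← ENNReal.ofReal_toReal (measure_ball_lt_top (μ := volume) (x := (0 : Rn n)) (r := 1)).ne,
        ← unitBallVol, ← ENNReal.ofReal_mul (by positivity), ← ENNReal.ofReal_mul (by positivity),
        sub_eq_neg_add, Real.rpow_add hr, Real.rpow_natCast]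
      congr 1
      ring
    _ ≤ _ := by
      apply ENNReal.ofReal_le_ofReal
      gcongr
      rw [mul_div_right_comm]
      exact le_mul_of_one_le_left hω ((one_le_div hns).2 (by linarith [hs.1]))
  calc rieszAt n s (ball x r) y
      ≤ ∫⁻ z in ball y r ∪ ball x r \ ball y r, ENNReal.ofReal (‖z - y‖ ^ (-s)) :=
        lintegral_mono_set (by rw [union_sdiff_self]; exact subset_union_right)
    _ ≤ _ := lintegral_union_le _ _ _
    _ ≤ _ := add_le_add hnear.le hfar
    _ = _ := by
      rw [← ENNReal.ofReal_add (by positivity) (by positivity)]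
      congr 1
      ring

lemma setLIntegral_smul_set {n : ℕ} {c : ℝ} (hc : 0 < c) (E : Set (Rn n)) (f : Rn n → ℝ≥0∞) :
    ∫⁻ x in c • E, f x = ENNReal.ofReal (c ^ n) * ∫⁻ x in E, f (c • x) := by
  have hemb : MeasurableEmbedding (fun x : Rn n => c • x) := measurableEmbedding_const_smul₀ hc.ne'
  have hmap := Measure.map_addHaar_smul (volume : Measure (Rn n)) hc.ne'
  have hpre : (fun x : Rn n => c • x) ⁻¹' (c • E) = E :=
    preimage_image_eq E (smul_right_injective (Rn n) hc.ne')
  have hcn : 0 < c ^ n := pow_pos hc n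
  rw [finrank_euclideanSpace, Fintype.card_fin, abs_of_pos (inv_pos.2 hcn)] at hmap
  have h := hemb.restrict_map volume (c • E)
  rw [hpre] at h
  rw [← hemb.lintegral_map, ← h]
  erw [hmap]
  rw [Measure.restrict_smul, lintegral_smul_measure, smul_eq_mul, ← mul_assoc,
    ← ENNReal.ofReal_mul hcn.le, mul_inv_cancel₀ hcn.ne', ENNReal.ofReal_one, one_mul]

lemma fracPer_smul {n : ℕ} (s : ℝ) {c : ℝ} (hc : 0 < c) (E : Set (Rn n)) :
    fracPer n s (c • E) = ENNReal.ofReal (c ^ ((n : ℝ) - s)) * fracPer n s E := by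
  have hcompl : (c • E)ᶜ = c • Eᶜ := (image_compl_eq (MulAction.bijective₀ hc.ne')).symm
  have hk : ∀ x y : Rn n, ENNReal.ofReal (‖c • x - c • y‖ ^ (-((n : ℝ) + s))) =
      ENNReal.ofReal (c ^ (-((n : ℝ) + s))) * ENNReal.ofReal (‖x - y‖ ^ (-((n : ℝ) + s))) := by
    intro x y
    rw [← smul_sub, norm_smul, Real.norm_of_nonneg hc.le,
      Real.mul_rpow hc.le (norm_nonneg _), ENNReal.ofReal_mul (Real.rpow_nonneg hc.le _)]
  simp only [fracPer, hcompl, setLIntegral_smul_set hc, hk,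
    lintegral_const_mul' _ _ ENNReal.ofReal_ne_top]
  rw [← mul_assoc, ← mul_assoc, ← ENNReal.ofReal_mul (by positivity),
    ← ENNReal.ofReal_mul (by positivity), ← Real.rpow_natCast, ← Real.rpow_add hc,
    ← Real.rpow_add hc]
  congr 3
  ring

lemma Vs_smul {n : ℕ} (s : ℝ) {c : ℝ} (hc : 0 < c) (E : Set (Rn n)) :
    Vs n s (c • E) = ENNReal.ofReal (c ^ ((n : ℝ) - s)) * Vs n s E := by
  have hat : ∀ y, rieszAt n s (c • E) (c • y) =
      ENNReal.ofReal (c ^ ((n : ℝ) - s)) * rieszAt n s E y := by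
    intro y
    have hk : ∀ x : Rn n, ENNReal.ofReal (‖c • x - c • y‖ ^ (-s)) =
        ENNReal.ofReal (c ^ (-s)) * ENNReal.ofReal (‖x - y‖ ^ (-s)) := by
      intro x
      rw [← smul_sub, norm_smul, Real.norm_of_nonneg hc.le,
        Real.mul_rpow hc.le (norm_nonneg _), ENNReal.ofReal_mul (Real.rpow_nonneg hc.le _)]
    simp only [rieszAt, setLIntegral_smul_set hc, hk,
      lintegral_const_mul' _ _ ENNReal.ofReal_ne_top]
    rw [← mul_assoc, ← ENNReal.ofReal_mul (by positivity), ← Real.rpow_natCast,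
      ← Real.rpow_add hc, ← sub_eq_add_neg]
  rw [Vs, Vs, ENNReal.mul_iSup, ← (MulAction.surjective₀ hc.ne').iSup_comp]
  simp only [hat]

lemma energy_smul {n : ℕ} (s ε : ℝ) {c : ℝ} (hc : 0 < c) (E : Set (Rn n)) :
    energy n s ε (c • E) = ENNReal.ofReal (c ^ ((n : ℝ) - s)) * energy n s ε E := by
  rw [energy, energy, fracPer_smul s hc, Vs_smul s hc, mul_add, mul_left_comm]

lemma Vs_le_add_of_symmDiff_subset_ball {n : ℕ} (hn : 0 < n) {s : ℝ} (hs : s ∈ Ico (0 : ℝ) n)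
    {r : ℝ} (hr : 0 < r) {x : Rn n} {E G : Set (Rn n)} (h : E ∆ G ⊆ ball x r) :
    Vs n s G ≤ Vs n s E +
      ENNReal.ofReal (2 * (n * unitBallVol n / (n - s)) * r ^ ((n : ℝ) - s)) := by
  refine iSup_le fun y => ?_
  have hsub : G ⊆ E ∪ ball x r := fun z hz => by
    by_cases hE : z ∈ E
    · exact Or.inl hE
    · exact Or.inr (h (Or.inr ⟨hz, hE⟩))
  calc rieszAt n s G y ≤ rieszAt n s (E ∪ ball x r) y := lintegral_mono_set hsub
    _ ≤ rieszAt n s E y + rieszAt n s (ball x r) y := lintegral_union_le _ _ _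
    _ ≤ _ := add_le_add (le_iSup (rieszAt n s E) y) (rieszAt_ball_le hn hs hr x y)

lemma energy_unitBall_ne_top {n : ℕ} (hn : 0 < n) {s : ℝ} (hs : s ∈ Ioo (0 : ℝ) 1) (ε : ℝ) :
    energy n s ε (ball (0 : Rn n) 1) ≠ ∞ := by
  have h1 : (1 : ℝ) ≤ n := by exact_mod_cast hn
  refine ENNReal.add_ne_top.2 ⟨fracPer_unitBall_ne_top hn hs,
    ENNReal.mul_ne_top ENNReal.ofReal_ne_top ?_⟩
  exact ne_top_of_le_ne_top ENNReal.ofReal_ne_top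
    (iSup_le fun y => rieszAt_ball_le hn ⟨hs.1.le, by linarith [hs.2]⟩ one_pos 0 y)

lemma energy_empty (n : ℕ) (s ε : ℝ) : energy n s ε (∅ : Set (Rn n)) = 0 := by
  simp [energy, fracPer, Vs, rieszAt]

lemma unitBallVol_pos (n : ℕ) : 0 < unitBallVol n :=
  ENNReal.toReal_pos (measure_ball_pos _ _ one_pos).ne' measure_ball_lt_top.ne

lemma tsum_comp_update {α : Type*} (φ : α → ℝ≥0∞) (F : ℕ → α) (k : ℕ) (G : α) :
    ∑' j, φ (Function.update F k G j) = φ G + ∑' j, if j = k then 0 else φ (F j) := by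
  rw [ENNReal.tsum_eq_add_tsum_ite k, Function.update_self]
  congr 2 with j
  by_cases h : j = k <;> simp [h]

lemma tsum_comp_eq_add_tsum_ite {α : Type*} (φ : α → ℝ≥0∞) (F : ℕ → α) (k : ℕ) :
    ∑' j, φ (F j) = φ (F k) + ∑' j, if j = k then 0 else φ (F j) := by
  simpa using tsum_comp_update φ F k (F k)

lemma genEnergy_ne_top_of_forall_le {n : ℕ} (hn : 0 < n) {s ε : ℝ} (hs : s ∈ Ioo (0 : ℝ) 1)
    {F : ℕ → Set (Rn n)}
    (hFmin : ∀ G : ℕ → Set (Rn n), (∀ k, MeasurableSet (G k)) →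
      (∑' k : ℕ, volume (G k)) = volume (ball (0 : Rn n) 1) →
      genEnergy n s ε F ≤ genEnergy n s ε G) :
    genEnergy n s ε F ≠ ∞ := by
  set B : ℕ → Set (Rn n) := Function.update (fun _ => ∅) 0 (ball 0 1)
  have hB : ∀ k, MeasurableSet (B k) := fun k => by
    by_cases h : k = 0
    · simp [B, h, measurableSet_ball]
    · simp [B, h]
  refine ne_top_of_le_ne_top (energy_unitBall_ne_top hn hs ε) ((hFmin B hB ?_).trans_eq ?_)
  · simp only [B, tsum_comp_update]
    simp
  · simp only [B, genEnergy, tsum_comp_update, energy_empty]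
    simp

lemma genEnergy_smul {n : ℕ} (s ε : ℝ) {c : ℝ} (hc : 0 < c) (H : ℕ → Set (Rn n)) :
    genEnergy n s ε (fun k => c • H k) =
      ENNReal.ofReal (c ^ ((n : ℝ) - s)) * genEnergy n s ε H := by
  simp only [genEnergy, energy_smul s ε hc, ENNReal.tsum_mul_left]

/-- A generalized minimizer almost minimizes the energy among sequences whose total volume is
slightly off, as one sees by rescaling the competitor. -/
lemma genEnergy_le_mul_of_forall_le {n : ℕ} (hn : 0 < n) {s ε : ℝ} (hsn : s ≤ n) (hs : 0 ≤ s)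
    {F H : ℕ → Set (Rn n)}
    (hFmin : ∀ G : ℕ → Set (Rn n), (∀ k, MeasurableSet (G k)) →
      (∑' k : ℕ, volume (G k)) = volume (ball (0 : Rn n) 1) →
      genEnergy n s ε F ≤ genEnergy n s ε G)
    (hH : ∀ k, MeasurableSet (H k)) {t : ℝ} (ht0 : 0 ≤ t) (ht : t ≤ 1 / 2)
    (hfin : (∑' k, volume (H k)) ≠ ∞)
    (hvol : volume (ball (0 : Rn n) 1) ≤
      (∑' k, volume (H k)) + ENNReal.ofReal t * volume (ball (0 : Rn n) 1)) :
    genEnergy n s ε F ≤ ENNReal.ofReal (1 + 2 * t) * genEnergy n s ε H := by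
  have hω := unitBallVol_pos n
  have hωeq : volume (ball (0 : Rn n) 1) = ENNReal.ofReal (unitBallVol n) :=
    (ENNReal.ofReal_toReal measure_ball_lt_top.ne).symm
  obtain ⟨v, hv0, hv⟩ : ∃ v : ℝ, 0 ≤ v ∧ (∑' k, volume (H k)) = ENNReal.ofReal v :=
    ⟨_, ENNReal.toReal_nonneg, (ENNReal.ofReal_toReal hfin).symm⟩
  rw [hωeq, hv, ← ENNReal.ofReal_mul ht0, ← ENNReal.ofReal_add hv0 (by positivity),
    ENNReal.ofReal_le_ofReal_iff (by positivity)] at hvol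
  have hvpos : 0 < v := by nlinarith
  set c : ℝ := (unitBallVol n / v) ^ ((n : ℝ)⁻¹)
  have hc : 0 < c := by positivity
  have hcn : c ^ n = unitBallVol n / v := Real.rpow_inv_natCast_pow (by positivity) hn.ne'
  have hbound : c ^ ((n : ℝ) - s) ≤ 1 + 2 * t := by
    rcases le_total c 1 with h1 | h1
    · linarith [Real.rpow_le_one hc.le h1 (sub_nonneg.2 hsn)]
    · calc c ^ ((n : ℝ) - s) ≤ c ^ (n : ℝ) := Real.rpow_le_rpow_of_exponent_le h1 (by linarith)
        _ = unitBallVol n / v := by rw [Real.rpow_natCast, hcn]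
        _ ≤ 1 + 2 * t := by
          rw [div_le_iff₀ hvpos]
          nlinarith [mul_nonneg hω.le (mul_nonneg ht0 (sub_nonneg.2 ht)),
            mul_le_mul_of_nonneg_left hvol (by linarith : 0 ≤ 1 + 2 * t)]
  have hscaled := hFmin (fun k => c • H k) (fun k => (hH k).const_smul₀ c) (by
    simp only [Measure.addHaar_smul_of_nonneg volume hc.le, finrank_euclideanSpace,
      Fintype.card_fin, ENNReal.tsum_mul_left, hv]
    rw [hωeq, ← ENNReal.ofReal_mul (by positivity), hcn, div_mul_cancel₀ _ hvpos.ne'])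
  rw [genEnergy_smul s ε hc] at hscaled
  refine hscaled.trans ?_
  gcongr

/-- **Components of generalized minimizers are `(ρ,R)`-minimizers of the `s`-perimeter**, with
`ρ(r) = ε₀ (10 n ω_n/(n-s)) r^{n-s}` and `R` sufficiently small. -/
theorem stmt_11 (n : ℕ) (hn : 2 ≤ n) (s : ℝ) (hs : s ∈ Set.Ioo (0 : ℝ) 1)
    (ε₀ ε : ℝ) (hε₀ : 0 < ε₀) (hε : ε ∈ Set.Ioc (0 : ℝ) ε₀)
    (F : ℕ → Set (Rn n)) (hFmeas : ∀ k, MeasurableSet (F k))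
    (hFvol : (∑' k : ℕ, volume (F k)) = volume (ball (0 : Rn n) 1))
    (hFmin : ∀ G : ℕ → Set (Rn n), (∀ k, MeasurableSet (G k)) →
      (∑' k : ℕ, volume (G k)) = volume (ball (0 : Rn n) 1) →
      genEnergy n s ε F ≤ genEnergy n s ε G) :
    ∃ R : ℝ, 0 < R ∧ ∀ (k : ℕ) (x : Rn n) (r : ℝ), 0 < r → r ≤ R →
      ∀ G : Set (Rn n), MeasurableSet G → closure (F k ∆ G) ⊆ ball x r →
        fracPer n s (F k) ≤ fracPer n s G +
          ENNReal.ofReal (ε₀ * (10 * n * unitBallVol n / ((n : ℝ) - s)) * r ^ ((n : ℝ) - s)) := by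
  obtain ⟨hs0, hs1⟩ := hs
  have hn0 : 0 < n := by omega
  have hn2 : (2 : ℝ) ≤ n := by exact_mod_cast hn
  have hns : 0 < (n : ℝ) - s := by linarith
  have hsn : s ∈ Ico (0 : ℝ) n := ⟨hs0.le, by linarith⟩
  have : Nonempty (Fin n) := ⟨⟨0, hn0⟩⟩
  have hfin : genEnergy n s ε F ≠ ∞ :=
    genEnergy_ne_top_of_forall_le hn0 ⟨hs0, hs1⟩ hFmin
  obtain ⟨T, hT0, hT⟩ : ∃ T : ℝ, 0 ≤ T ∧ genEnergy n s ε F = ENNReal.ofReal T :=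
    ⟨_, ENNReal.toReal_nonneg, (ENNReal.ofReal_toReal hfin).symm⟩
  set A : ℝ := n * unitBallVol n / (n - s) with hA
  have hApos : 0 < A := div_pos (mul_pos (by linarith) (unitBallVol_pos n)) hns
  set b : ℝ := min (1 / 2) (4 * ε₀ * A / (T + 2 * ε₀ * A)) with hb
  have hbpos : 0 < b := lt_min (by norm_num) (by positivity)
  refine ⟨b ^ (1 / s), by positivity, fun k x r hr hrR G hG hsub => ?_⟩
  have hrs : r ^ s ≤ b := by
    calc r ^ s ≤ (b ^ (1 / s)) ^ s := Real.rpow_le_rpow hr.le hrR hs0.le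
      _ = b := by rw [← Real.rpow_mul hbpos.le, one_div_mul_cancel hs0.ne', Real.rpow_one]
  have hr1 : r ≤ 1 := by
    by_contra! h
    linarith [Real.one_lt_rpow h hs0, min_le_left (1 / 2) (4 * ε₀ * A / (T + 2 * ε₀ * A))]
  set p : ℝ := r ^ ((n : ℝ) - s) with hp
  have hp0 : 0 < p := Real.rpow_pos_of_pos hr _
  have hp1 : p ≤ 1 := Real.rpow_le_one hr.le hr1 hns.le
  have hrn : r ^ n = r ^ s * p := by
    rw [hp, ← Real.rpow_add hr, add_sub_cancel, Real.rpow_natCast]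
  have hrs0 : 0 < r ^ s := Real.rpow_pos_of_pos hr _
  have hrn2 : r ^ n ≤ 1 / 2 := by
    rw [hrn]
    calc r ^ s * p ≤ r ^ s := mul_le_of_le_one_right hrs0.le hp1
      _ ≤ 1 / 2 := hrs.trans (min_le_left _ _)
  have hsmall : 2 * r ^ n * (T + ε * (2 * A * p)) ≤ 8 * ε₀ * A * p := by
    have h1 : r ^ s * (T + 2 * ε₀ * A) ≤ 4 * ε₀ * A :=
      (le_div_iff₀ (by positivity)).1 (hrs.trans (min_le_right _ _))
    have h2 : ε * (2 * A * p) ≤ 2 * ε₀ * A := by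
      calc ε * (2 * A * p) ≤ ε₀ * (2 * A * 1) := by gcongr; exact hε.2
        _ = 2 * ε₀ * A := by ring
    calc 2 * r ^ n * (T + ε * (2 * A * p)) ≤ 2 * r ^ n * (T + 2 * ε₀ * A) := by gcongr
      _ = 2 * p * (r ^ s * (T + 2 * ε₀ * A)) := by rw [hrn]; ring
      _ ≤ 2 * p * (4 * ε₀ * A) := by gcongr
      _ = 8 * ε₀ * A * p := by ring
  rcases le_total (fracPer n s (F k)) (fracPer n s G) with hle | hle
  · exact hle.trans le_self_add
  have hsub' : F k ∆ G ⊆ ball x r := subset_closure.trans hsub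
  have hV : Vs n s G ≤ Vs n s (F k) + ENNReal.ofReal (2 * A * p) :=
    Vs_le_add_of_symmDiff_subset_ball hn0 hsn hr hsub'
  have hball : volume (ball x r) = ENNReal.ofReal (r ^ n) * volume (ball (0 : Rn n) 1) := by
    rw [Measure.addHaar_ball volume x hr.le, finrank_euclideanSpace, Fintype.card_fin]
  have hvol₁ : volume (F k) ≤ volume G + volume (ball x r) :=
    (measure_mono fun z hz => by
      by_cases hzG : z ∈ G
      · exact Or.inl hzG
      · exact Or.inr (hsub' (Or.inl ⟨hz, hzG⟩))).trans (measure_union_le _ _)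
  have hvol₂ : volume G ≤ volume (F k) + volume (ball x r) :=
    (measure_mono fun z hz => by
      by_cases hzF : z ∈ F k
      · exact Or.inl hzF
      · exact Or.inr (hsub' (Or.inr ⟨hz, hzF⟩))).trans (measure_union_le _ _)
  have hmeas : ∀ j, MeasurableSet (Function.update F k G j) := fun j => by
    by_cases h : j = k
    · subst h
      simpa using hG
    · simpa [h] using hFmeas j
  have hle₁ : volume (ball (0 : Rn n) 1) ≤ (∑' j, volume (Function.update F k G j)) +
      ENNReal.ofReal (r ^ n) * volume (ball (0 : Rn n) 1) := by
    rw [← hball, ← hFvol, tsum_comp_update, tsum_comp_eq_add_tsum_ite volume F k, add_right_comm]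
    gcongr
  have hne : (∑' j, volume (Function.update F k G j)) ≠ ∞ := by
    refine ne_top_of_le_ne_top (ENNReal.add_ne_top.2
      ⟨measure_ball_lt_top.ne, measure_ball_lt_top.ne⟩ :
        volume (ball (0 : Rn n) 1) + volume (ball x r) ≠ ∞) ?_
    rw [← hFvol, tsum_comp_update, tsum_comp_eq_add_tsum_ite volume F k,
      add_right_comm]
    gcongr
  have hmin := genEnergy_le_mul_of_forall_le hn0 (by linarith) hs0.le hFmin hmeas
    (pow_nonneg hr.le n) hrn2 hne hle₁
  set S : ℝ≥0∞ := ∑' j, if j = k then 0 else energy n s ε (F j) with hS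
  have hFS : genEnergy n s ε F = energy n s ε (F k) + S :=
    tsum_comp_eq_add_tsum_ite _ _ _
  have hGS : genEnergy n s ε (Function.update F k G) = energy n s ε G + S :=
    tsum_comp_update _ _ _ _
  have hSfin : S ≠ ∞ := ne_top_of_le_ne_top hfin (hFS ▸ le_add_self)
  have hVfin : ENNReal.ofReal ε * Vs n s (F k) ≠ ∞ :=
    ne_top_of_le_ne_top hfin (hFS ▸ le_add_right le_add_self)
  have hεV : ENNReal.ofReal ε * Vs n s G ≤
      ENNReal.ofReal ε * Vs n s (F k) + ENNReal.ofReal (ε * (2 * A * p)) := by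
    rw [ENNReal.ofReal_mul hε.1.le, ← mul_add]
    gcongr
  have hup : energy n s ε G + S ≤ ENNReal.ofReal (T + ε * (2 * A * p)) := by
    rw [ENNReal.ofReal_add hT0 (mul_nonneg hε.1.le (by positivity)), ← hT, hFS, add_right_comm]
    gcongr
    rw [energy, energy, add_assoc]
    gcongr
  have hcancel : energy n s ε (F k) ≤ energy n s ε G +
      ENNReal.ofReal (2 * r ^ n * (T + ε * (2 * A * p))) := by
    rw [← ENNReal.add_le_add_iff_right hSfin, ← hFS, add_right_comm, ← hGS]
    refine hmin.trans ?_
    rw [ENNReal.ofReal_add zero_le_one (by positivity), ENNReal.ofReal_one, add_mul, one_mul,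
      ENNReal.ofReal_mul (p := 2 * r ^ n) (by positivity)]
    gcongr
    exact hGS.trans_le hup
  rw [← ENNReal.add_le_add_iff_right hVfin]
  calc fracPer n s (F k) + ENNReal.ofReal ε * Vs n s (F k)
      ≤ fracPer n s G + ENNReal.ofReal ε * Vs n s G +
        ENNReal.ofReal (2 * r ^ n * (T + ε * (2 * A * p))) := hcancel
    _ ≤ fracPer n s G + (ENNReal.ofReal ε * Vs n s (F k) + ENNReal.ofReal (ε * (2 * A * p))) +
        ENNReal.ofReal (8 * ε₀ * A * p) := by gcongr
    _ = fracPer n s G + ENNReal.ofReal (ε * (2 * A * p) + 8 * ε₀ * A * p) +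
        ENNReal.ofReal ε * Vs n s (F k) := by
      rw [ENNReal.ofReal_add (mul_nonneg hε.1.le (by positivity)) (by positivity)]
      ring
    _ ≤ _ := by
      gcongr
      calc ε * (2 * A * p) + 8 * ε₀ * A * p ≤ ε₀ * (2 * A * p) + 8 * ε₀ * A * p := by
            gcongr
            exact hε.2
        _ = ε₀ * (10 * n * unitBallVol n / (n - s)) * p := by
            rw [hA]
            ring
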